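/- Let λ be a partition of n, let i ∈ {0,1}, let d ∈ {0,1}ⁿ, and let M = M(λ,i) be the shape module of shape λ and parity i. Then M admits a Λ-composition series of type d if and only if there exists a standard tableau of shape λ whose i-parity equals d. (This is the non-emptiness criterion for the generalized flag variety 𝓕^Λ_d(M), whose Euler characteristic Theorem 1 identifies with |Tab^{(i)}(λ; d)|.) -/

import Mathlib

def IsPartition (l : ℕ → ℕ) : Prop :=
  (∀ m n : ℕ, m ≤ n → l n ≤ l m) ∧ ∃ N, ∀ n, N ≤ n → l n = 0

def boxes (l : ℕ → ℕ) : Set (ℕ × ℕ) := {b | b.2 < l b.1}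

noncomputable def psize (l : ℕ → ℕ) : ℕ := ∑ᶠ s, l s

def boxParity (i s t : ℕ) : ℕ := (s + t + i) % 2

/-- The ambient vector space with basis indexed by `ℕ × ℕ`. -/
abbrev Amb : Type := (ℕ × ℕ) →₀ ℂ

/-- The basis vector `v_{s,t}`. -/
noncomputable def vB (b : ℕ × ℕ) : Amb := Finsupp.single b 1

/-- `α`: on `v_{s,t}` with `s+t+i` even gives `v_{s,t-1}` (0 if `t = 0`), else 0. -/
noncomputable def opAlpha (i : ℕ) : Amb →ₗ[ℂ] Amb :=
  Finsupp.lift _ ℂ _ fun b =>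
    if boxParity i b.1 b.2 = 0 ∧ 1 ≤ b.2 then vB (b.1, b.2 - 1) else 0

/-- `β`: on `v_{s,t}` with `s+t+i` odd gives `v_{s,t-1}` (0 if `t = 0`), else 0. -/
noncomputable def opBeta (i : ℕ) : Amb →ₗ[ℂ] Amb :=
  Finsupp.lift _ ℂ _ fun b =>
    if boxParity i b.1 b.2 = 1 ∧ 1 ≤ b.2 then vB (b.1, b.2 - 1) else 0

/-- `α*`: on `v_{s,t}` with `s+t+i` odd gives `v_{s-1,t}` (0 if `s = 0`), else 0. -/
noncomputable def opAlphaStar (i : ℕ) : Amb →ₗ[ℂ] Amb :=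
  Finsupp.lift _ ℂ _ fun b =>
    if boxParity i b.1 b.2 = 1 ∧ 1 ≤ b.1 then vB (b.1 - 1, b.2) else 0

/-- `β*`: on `v_{s,t}` with `s+t+i` even gives `v_{s-1,t}` (0 if `s = 0`), else 0. -/
noncomputable def opBetaStar (i : ℕ) : Amb →ₗ[ℂ] Amb :=
  Finsupp.lift _ ℂ _ fun b =>
    if boxParity i b.1 b.2 = 0 ∧ 1 ≤ b.1 then vB (b.1 - 1, b.2) else 0

/-- `δ = α + β`. -/
noncomputable def opDelta (i : ℕ) : Amb →ₗ[ℂ] Amb := opAlpha i + opBeta i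

/-- The shape module `M(λ, i)`, realised as the span of the box vectors. -/
noncomputable def shapeModule (l : ℕ → ℕ) : Submodule ℂ Amb :=
  Submodule.span ℂ (vB '' boxes l)

/-- `E_p`: the span of the box vectors of `i`-parity `p`. -/
noncomputable def Epart (l : ℕ → ℕ) (i p : ℕ) : Submodule ℂ Amb :=
  Submodule.span ℂ (vB '' {b ∈ boxes l | boxParity i b.1 b.2 = p})

/-- Stability of a subspace under the four operators. -/
def LamStable (i : ℕ) (V : Submodule ℂ Amb) : Prop :=
  (∀ x ∈ V, opAlpha i x ∈ V) ∧ (∀ x ∈ V, opBeta i x ∈ V) ∧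
  (∀ x ∈ V, opAlphaStar i x ∈ V) ∧ (∀ x ∈ V, opBetaStar i x ∈ V)

/-- `V` is a Λ-submodule of `M(λ,i)`. -/
def IsLamSubmodule (l : ℕ → ℕ) (i : ℕ) (V : Submodule ℂ Amb) : Prop :=
  V ≤ shapeModule l ∧ LamStable i V ∧ V = (V ⊓ Epart l i 0) ⊔ (V ⊓ Epart l i 1)

/-- A Λ-composition series of `M(λ,i)` of type `d`. -/
def IsCompSeries (l : ℕ → ℕ) (i n : ℕ) (d : ℕ → ℕ) (V : ℕ → Submodule ℂ Amb) : Prop :=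
  V 0 = ⊥ ∧ V n = shapeModule l ∧
  (∀ t, 1 ≤ t → t ≤ n → V (t - 1) ≤ V t) ∧
  (∀ t, t ≤ n → IsLamSubmodule l i (V t)) ∧
  (∀ t, t ≤ n → Module.finrank ℂ (V t) = t) ∧
  (∀ t, 1 ≤ t → t ≤ n →
    Module.finrank ℂ (V t ⊓ Epart l i (d t) : Submodule ℂ Amb) =
      Module.finrank ℂ (V (t - 1) ⊓ Epart l i (d t) : Submodule ℂ Amb) + 1)

/-- Standard tableau of shape `l` with `|λ| = n`. -/
def IsStandardTableau (l : ℕ → ℕ) (n : ℕ) (T : ℕ × ℕ → ℕ) : Prop :=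
  Set.BijOn T (boxes l) (Set.Icc 1 n) ∧
  (∀ s t t' : ℕ, t < t' → (s, t') ∈ boxes l → T (s, t) < T (s, t')) ∧
  (∀ s s' t : ℕ, s < s' → (s', t) ∈ boxes l → T (s, t) < T (s', t))

open Finsupp in
theorem opAlpha_apply (i : ℕ) (x : Amb) (s t : ℕ) :
    opAlpha i x (s, t) = if boxParity i s (t + 1) = 0 then x (s, t + 1) else 0 := by
  induction x using Finsupp.induction_linear with
  | zero => simp
  | add f g hf hg => rw [map_add, Finsupp.add_apply, hf, hg]; split_ifs <;> simp
  | single b r =>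
    obtain ⟨u, v⟩ := b
    rcases v with _ | v
    · simp [opAlpha, vB]
    · by_cases h : u = s ∧ v = t
      · obtain ⟨rfl, rfl⟩ := h
        simp only [opAlpha, vB, lift_apply, zero_smul, sum_single_index]
        split_ifs <;> simp_all
      · simp only [opAlpha, vB, lift_apply, zero_smul, sum_single_index]
        split_ifs <;> simp_all

open Finsupp in
theorem opBeta_apply (i : ℕ) (x : Amb) (s t : ℕ) :
    opBeta i x (s, t) = if boxParity i s (t + 1) = 1 then x (s, t + 1) else 0 := by
  induction x using Finsupp.induction_linear with
  | zero => simp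
  | add f g hf hg => rw [map_add, Finsupp.add_apply, hf, hg]; split_ifs <;> simp
  | single b r =>
    obtain ⟨u, v⟩ := b
    rcases v with _ | v
    · simp [opBeta, vB]
    · by_cases h : u = s ∧ v = t
      · obtain ⟨rfl, rfl⟩ := h
        simp only [opBeta, vB, lift_apply, zero_smul, sum_single_index]
        split_ifs <;> simp_all
      · simp only [opBeta, vB, lift_apply, zero_smul, sum_single_index]
        split_ifs <;> simp_all

open Finsupp in
theorem opAlphaStar_apply (i : ℕ) (x : Amb) (s t : ℕ) :
    opAlphaStar i x (s, t) = if boxParity i (s + 1) t = 1 then x (s + 1, t) else 0 := by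
  induction x using Finsupp.induction_linear with
  | zero => simp
  | add f g hf hg => rw [map_add, Finsupp.add_apply, hf, hg]; split_ifs <;> simp
  | single b r =>
    obtain ⟨u, v⟩ := b
    rcases u with _ | u
    · simp [opAlphaStar, vB]
    · by_cases h : u = s ∧ v = t
      · obtain ⟨rfl, rfl⟩ := h
        simp only [opAlphaStar, vB, lift_apply, zero_smul, sum_single_index]
        split_ifs <;> simp_all
      · simp only [opAlphaStar, vB, lift_apply, zero_smul, sum_single_index]
        split_ifs <;> simp_all

open Finsupp in
theorem opBetaStar_apply (i : ℕ) (x : Amb) (s t : ℕ) :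
    opBetaStar i x (s, t) = if boxParity i (s + 1) t = 0 then x (s + 1, t) else 0 := by
  induction x using Finsupp.induction_linear with
  | zero => simp
  | add f g hf hg => rw [map_add, Finsupp.add_apply, hf, hg]; split_ifs <;> simp
  | single b r =>
    obtain ⟨u, v⟩ := b
    rcases u with _ | u
    · simp [opBetaStar, vB]
    · by_cases h : u = s ∧ v = t
      · obtain ⟨rfl, rfl⟩ := h
        simp only [opBetaStar, vB, lift_apply, zero_smul, sum_single_index]
        split_ifs <;> simp_all
      · simp only [opBetaStar, vB, lift_apply, zero_smul, sum_single_index]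
        split_ifs <;> simp_all

theorem boxParity_eq_zero_or_one (i s t : ℕ) : boxParity i s t = 0 ∨ boxParity i s t = 1 :=
  Nat.mod_two_eq_zero_or_one _

theorem opAlpha_add_opBeta_apply (i : ℕ) (x : Amb) (s t : ℕ) :
    (opAlpha i x + opBeta i x) (s, t) = x (s, t + 1) := by
  rw [Finsupp.add_apply, opAlpha_apply, opBeta_apply]
  rcases boxParity_eq_zero_or_one i s (t + 1) with h | h <;> simp [h]

theorem opAlphaStar_add_opBetaStar_apply (i : ℕ) (x : Amb) (s t : ℕ) :
    (opAlphaStar i x + opBetaStar i x) (s, t) = x (s + 1, t) := by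
  rw [Finsupp.add_apply, opAlphaStar_apply, opBetaStar_apply]
  rcases boxParity_eq_zero_or_one i (s + 1) t with h | h <;> simp [h]

theorem span_vB_image (S : Set (ℕ × ℕ)) :
    Submodule.span ℂ (vB '' S) = Finsupp.supported ℂ ℂ S :=
  (Finsupp.supported_eq_span_single ℂ S).symm

theorem mem_supported_iff_forall {S : Set (ℕ × ℕ)} {x : Amb} :
    x ∈ Finsupp.supported ℂ ℂ S ↔ ∀ b, x b ≠ 0 → b ∈ S := by
  rw [Finsupp.mem_supported']
  exact forall_congr' fun b => not_imp_comm

theorem boxes_finite {l : ℕ → ℕ} (hl : IsPartition l) : (boxes l).Finite := by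
  obtain ⟨hmono, N, hN⟩ := hl
  refine ((Set.finite_Iio N).prod (Set.finite_Iio (l 0))).subset ?_
  rintro ⟨s, t⟩ hb
  have hb : t < l s := hb
  refine ⟨?_, lt_of_lt_of_le hb (hmono 0 s (Nat.zero_le _))⟩
  by_contra h
  have := hN s (not_lt.1 h)
  omega

/-- The positions of lexicographically leading terms of elements of `V`. -/
def leadSet (V : Submodule ℂ Amb) : Set (ℕ × ℕ) :=
  {b | ∃ x ∈ V, x b ≠ 0 ∧ ∀ c, x c ≠ 0 → toLex c ≤ toLex b}

theorem leadSet_mono {V W : Submodule ℂ Amb} (h : V ≤ W) : leadSet V ⊆ leadSet W :=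
  fun _ ⟨x, hx, hb⟩ => ⟨x, h hx, hb⟩

theorem leadSet_subset {V : Submodule ℂ Amb} {S : Set (ℕ × ℕ)}
    (h : V ≤ Finsupp.supported ℂ ℂ S) : leadSet V ⊆ S :=
  fun b ⟨_, hx, hb, _⟩ => mem_supported_iff_forall.1 (h hx) b hb

theorem leadSet_supported (S : Set (ℕ × ℕ)) : leadSet (Finsupp.supported ℂ ℂ S) = S := by
  refine (leadSet_subset le_rfl).antisymm fun b hb =>
    ⟨Finsupp.single b 1, Finsupp.single_mem_supported ℂ 1 hb, by simp, fun c hc => ?_⟩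
  have : b = c := by
    by_contra h
    simp [h] at hc
  rw [this]

theorem finiteDimensional_of_le_supported {V : Submodule ℂ Amb} {S : Set (ℕ × ℕ)}
    (hS : S.Finite) (h : V ≤ Finsupp.supported ℂ ℂ S) : FiniteDimensional ℂ V := by
  have : FiniteDimensional ℂ (Finsupp.supported ℂ ℂ S) := by
    rw [← span_vB_image]
    exact FiniteDimensional.span_of_finite ℂ (hS.image _)
  exact Submodule.finiteDimensional_of_le h

theorem finrank_eq_finrank_inf_ker_add_one {E : Type*} [AddCommGroup E] [Module ℂ E]
    (V : Submodule ℂ E) [FiniteDimensional ℂ V] (φ : E →ₗ[ℂ] ℂ) (h : ∃ x ∈ V, φ x ≠ 0) :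
    Module.finrank ℂ V = Module.finrank ℂ (V ⊓ LinearMap.ker φ : Submodule ℂ E) + 1 := by
  obtain ⟨x, hx, hne⟩ := h
  have hsurj : LinearMap.range (φ.domRestrict V) = ⊤ :=
    LinearMap.range_eq_top.2 <| LinearMap.surjective fun h0 =>
      hne <| by simpa using LinearMap.congr_fun h0 ⟨x, hx⟩
  have hker : Module.finrank ℂ (LinearMap.ker (φ.domRestrict V)) =
      Module.finrank ℂ (V ⊓ LinearMap.ker φ : Submodule ℂ E) := by
    rw [LinearMap.ker_domRestrict, ← Submodule.finrank_map_subtype_eq, Submodule.map_comap_subtype]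
  have := LinearMap.finrank_range_add_finrank_ker (φ.domRestrict V)
  rw [hsurj, finrank_top, Module.finrank_self, hker] at this
  omega

theorem finrank_eq_ncard_leadSet_of_finset (S : Finset (ℕ × ℕ)) :
    ∀ V : Submodule ℂ Amb, V ≤ Finsupp.supported ℂ ℂ (S : Set (ℕ × ℕ)) →
      Module.finrank ℂ V = (leadSet V).ncard := by
  induction S using Finset.induction_on_max_value (toLex : ℕ × ℕ → ℕ ×ₗ ℕ) with
  | empty =>
    intro V hV
    have h : leadSet V = ∅ := Set.subset_empty_iff.1 (by simpa using leadSet_subset hV)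
    have : V = ⊥ := by simpa using hV
    rw [h, this]
    simp
  | insert m S hm hmax ih =>
    intro V hV
    by_cases hex : ∃ x ∈ V, Finsupp.lapply (R := ℂ) m x ≠ 0
    · have : FiniteDimensional ℂ V :=
        finiteDimensional_of_le_supported (insert m S).finite_toSet hV
      set V' := V ⊓ LinearMap.ker (Finsupp.lapply (R := ℂ) (M := ℂ) m)
      have hV'S : V' ≤ Finsupp.supported ℂ ℂ (S : Set (ℕ × ℕ)) := by
        rintro x ⟨hx, hx0⟩
        rw [mem_supported_iff_forall]
        intro b hb
        rcases Finset.mem_insert.1 (mem_supported_iff_forall.1 (hV hx) b hb) with rfl | h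
        · exact absurd hx0 hb
        · exact h
      have hlead : leadSet V = insert m (leadSet V') := by
        refine Set.Subset.antisymm ?_ (Set.insert_subset ?_ (leadSet_mono inf_le_left))
        · rintro b ⟨x, hx, hb, hbmax⟩
          by_cases hxm : x m = 0
          · exact Or.inr ⟨x, ⟨hx, hxm⟩, hb, hbmax⟩
          · refine Or.inl ?_
            rcases Finset.mem_insert.1 (mem_supported_iff_forall.1 (hV hx) b hb) with h | h
            · exact h
            · exact toLex.injective ((hmax b h).antisymm (hbmax m hxm))
        · obtain ⟨x, hx, hxm⟩ := hex
          refine ⟨x, hx, hxm, fun c hc => ?_⟩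
          rcases Finset.mem_insert.1 (mem_supported_iff_forall.1 (hV hx) c hc) with rfl | h
          · exact le_rfl
          · exact hmax c h
      have hmem : m ∉ leadSet V' := fun h => hm (leadSet_subset hV'S h)
      rw [hlead, Set.ncard_insert_of_notMem hmem (S.finite_toSet.subset (leadSet_subset hV'S)),
        ← ih V' hV'S]
      exact finrank_eq_finrank_inf_ker_add_one V _ hex
    · push Not at hex
      refine ih V fun x hx => mem_supported_iff_forall.2 fun b hb => ?_
      rcases Finset.mem_insert.1 (mem_supported_iff_forall.1 (hV hx) b hb) with rfl | h
      · exact absurd (hex x hx) hb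
      · exact h

theorem finrank_eq_ncard_leadSet {V : Submodule ℂ Amb} {S : Set (ℕ × ℕ)} (hS : S.Finite)
    (hV : V ≤ Finsupp.supported ℂ ℂ S) : Module.finrank ℂ V = (leadSet V).ncard :=
  finrank_eq_ncard_leadSet_of_finset hS.toFinset V (by simpa using hV)

theorem finrank_supported {S : Set (ℕ × ℕ)} (hS : S.Finite) :
    Module.finrank ℂ (Finsupp.supported ℂ ℂ S) = S.ncard := by
  rw [finrank_eq_ncard_leadSet hS le_rfl, leadSet_supported]

theorem mem_leadSet_left {i : ℕ} {V : Submodule ℂ Amb} (hV : LamStable i V) {s t : ℕ}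
    (h : (s, t + 1) ∈ leadSet V) : (s, t) ∈ leadSet V := by
  obtain ⟨x, hx, hb, hmax⟩ := h
  refine ⟨opAlpha i x + opBeta i x, V.add_mem (hV.1 x hx) (hV.2.1 x hx), ?_, ?_⟩
  · rwa [opAlpha_add_opBeta_apply]
  · rintro ⟨u, v⟩ hc
    rw [opAlpha_add_opBeta_apply] at hc
    have := hmax _ hc
    simp only [Prod.Lex.toLex_le_toLex] at this ⊢
    omega

theorem mem_leadSet_up {i : ℕ} {V : Submodule ℂ Amb} (hV : LamStable i V) {s t : ℕ}
    (h : (s + 1, t) ∈ leadSet V) : (s, t) ∈ leadSet V := by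
  obtain ⟨x, hx, hb, hmax⟩ := h
  refine ⟨opAlphaStar i x + opBetaStar i x,
    V.add_mem (hV.2.2.1 x hx) (hV.2.2.2 x hx), ?_, ?_⟩
  · rwa [opAlphaStar_add_opBetaStar_apply]
  · rintro ⟨u, v⟩ hc
    rw [opAlphaStar_add_opBetaStar_apply] at hc
    have := hmax _ hc
    simp only [Prod.Lex.toLex_le_toLex] at this ⊢
    omega

theorem mem_leadSet_of_le {i : ℕ} {V : Submodule ℂ Amb} (hV : LamStable i V) {s t s' t' : ℕ}
    (hs : s ≤ s') (ht : t ≤ t') (h : (s', t') ∈ leadSet V) : (s, t) ∈ leadSet V := by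
  have h1 : (s, t') ∈ leadSet V := by
    induction s', hs using Nat.le_induction with
    | base => exact h
    | succ k _ ih => exact ih (mem_leadSet_up hV h)
  induction t', ht using Nat.le_induction with
  | base => exact h1
  | succ k _ ih =>
    exact ih (mem_leadSet_left hV h) (mem_leadSet_left hV h1)

theorem mem_Epart_iff {l : ℕ → ℕ} {i p : ℕ} {x : Amb} :
    x ∈ Epart l i p ↔ ∀ b, x b ≠ 0 → b ∈ boxes l ∧ boxParity i b.1 b.2 = p := by
  rw [Epart, span_vB_image, mem_supported_iff_forall]
  rfl

theorem leadSet_inf_Epart {l : ℕ → ℕ} {i : ℕ} {V : Submodule ℂ Amb}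
    (hV : IsLamSubmodule l i V) {p : ℕ} (hp : p ≤ 1) :
    leadSet (V ⊓ Epart l i p) = leadSet V ∩ {b | boxParity i b.1 b.2 = p} := by
  ext b
  constructor
  · rintro ⟨x, ⟨hxV, hxE⟩, hb, hmax⟩
    exact ⟨⟨x, hxV, hb, hmax⟩, (mem_Epart_iff.1 hxE b hb).2⟩
  · rintro ⟨⟨x, hx, hb, hmax⟩, hbp⟩
    have key : ∀ q, q ≠ p → ∀ y ∈ V ⊓ Epart l i p, ∀ z ∈ V ⊓ Epart l i q, y + z = x →
        b ∈ leadSet (V ⊓ Epart l i p) := by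
      rintro q hqp y hy z hz rfl
      have hz0 : ∀ c : ℕ × ℕ, boxParity i c.1 c.2 = p → z c = 0 := fun c hc => by
        by_contra h
        exact hqp ((mem_Epart_iff.1 hz.2 c h).2.symm.trans hc)
      refine ⟨y, hy, ?_, fun c hc => hmax c ?_⟩
      · simpa [hz0 b hbp] using hb
      · simpa [hz0 c (mem_Epart_iff.1 hy.2 c hc).2] using hc
    have hx' := hx
    rw [hV.2.2] at hx'
    obtain ⟨y, hy, z, hz, hyz⟩ := Submodule.mem_sup.1 hx'
    interval_cases p
    · exact key 1 one_ne_zero y hy z hz hyz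
    · exact key 0 zero_ne_one z hz y hy ((add_comm z y).trans hyz)

theorem exists_tableau_of_compSeries {l : ℕ → ℕ} (hl : IsPartition l) {n i : ℕ} {d : ℕ → ℕ}
    (hd : ∀ t, d t ≤ 1) {V : ℕ → Submodule ℂ Amb} (hV : IsCompSeries l i n d V) :
    ∃ T : ℕ × ℕ → ℕ, IsStandardTableau l n T ∧
      ∀ b ∈ boxes l, boxParity i b.1 b.2 = d (T b) := by
  obtain ⟨hV0, hVn, hstep, hsub, hrank, htype⟩ := hV
  have hfin := boxes_finite hl
  have hle : ∀ t ≤ n, V t ≤ Finsupp.supported ℂ ℂ (boxes l) := fun t ht => by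
    have := (hsub t ht).1
    rwa [shapeModule, span_vB_image] at this
  have hLsub : ∀ t ≤ n, leadSet (V t) ⊆ boxes l := fun t ht => leadSet_subset (hle t ht)
  have hLn : leadSet (V n) = boxes l := by
    rw [hVn, shapeModule, span_vB_image, leadSet_supported]
  have hL0 : leadSet (V 0) = ∅ := by
    rw [hV0]
    exact Set.eq_empty_of_forall_notMem fun b ⟨x, hx, hb, _⟩ =>
      hb (by rw [(Submodule.mem_bot ℂ).1 hx]; rfl)
  have hmono : ∀ s t, s ≤ t → t ≤ n → leadSet (V s) ⊆ leadSet (V t) := by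
    intro s t hst
    induction t, hst using Nat.le_induction with
    | base => exact fun _ => subset_rfl
    | succ k _ ih =>
      exact fun hk => (ih (by omega)).trans (leadSet_mono (hstep (k + 1) (by omega) hk))
  have hcard : ∀ t ≤ n, (leadSet (V t)).ncard = t := fun t ht => by
    rw [← finrank_eq_ncard_leadSet hfin (hle t ht), hrank t ht]
  have hnew : ∀ t, 1 ≤ t → t ≤ n →
      ∃ b, leadSet (V t) \ leadSet (V (t - 1)) = {b} ∧ boxParity i b.1 b.2 = d t := by
    intro t ht htn
    have hss := hmono (t - 1) t (by omega) htn
    have h1 : (leadSet (V t) \ leadSet (V (t - 1))).ncard = 1 := by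
      rw [Set.ncard_sdiff hss (hfin.subset (hLsub _ (by omega))), hcard t htn,
        hcard (t - 1) (by omega)]
      omega
    obtain ⟨b, hb⟩ := Set.ncard_eq_one.1 h1
    refine ⟨b, hb, ?_⟩
    have h2 := htype t ht htn
    rw [finrank_eq_ncard_leadSet hfin (inf_le_left.trans (hle t htn)),
      finrank_eq_ncard_leadSet hfin (inf_le_left.trans (hle (t - 1) (by omega))),
      leadSet_inf_Epart (hsub t htn) (hd t),
      leadSet_inf_Epart (hsub (t - 1) (by omega)) (hd t)] at h2
    obtain ⟨c, hc, hc'⟩ := Set.exists_mem_notMem_of_ncard_lt_ncard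
      (lt_of_lt_of_eq (Nat.lt_succ_self _) h2.symm)
      ((hfin.subset (hLsub _ (by omega))).inter_of_left _)
    have hcb : c ∈ leadSet (V t) \ leadSet (V (t - 1)) := ⟨hc.1, fun h => hc' ⟨h, hc.2⟩⟩
    rw [hb] at hcb
    rw [← Set.mem_singleton_iff.1 hcb]
    exact hc.2
  set T : ℕ × ℕ → ℕ := fun b => sInf {t | b ∈ leadSet (V t)}
  have hTle : ∀ b t, b ∈ leadSet (V t) → T b ≤ t := fun b t h => Nat.sInf_le h
  have hTmem : ∀ b ∈ boxes l, b ∈ leadSet (V (T b)) := fun b hb =>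
    Nat.sInf_mem (s := {t | b ∈ leadSet (V t)}) ⟨n, hLn.superset hb⟩
  have hTn : ∀ b ∈ boxes l, T b ≤ n := fun b hb => hTle b n (by rwa [hLn])
  have hT1 : ∀ b ∈ boxes l, 1 ≤ T b := fun b hb => by
    by_contra h
    have h0 : T b = 0 := by omega
    have := hTmem b hb
    rw [h0, hL0] at this
    exact this
  have hTdiff : ∀ b ∈ boxes l, b ∈ leadSet (V (T b)) \ leadSet (V (T b - 1)) := fun b hb =>
    ⟨hTmem b hb, fun h => by have := hTle b _ h; have := hT1 b hb; omega⟩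
  have hinj : Set.InjOn T (boxes l) := by
    intro b hb c hc hbc
    obtain ⟨a, ha, -⟩ := hnew (T b) (hT1 b hb) (hTn b hb)
    have h1 := hTdiff b hb
    have h2 := hTdiff c hc
    rw [← hbc, ha] at h2
    rw [ha] at h1
    exact h1.trans h2.symm
  have hdown : ∀ s t s' t', s ≤ s' → t ≤ t' → (s, t) ≠ (s', t') → (s', t') ∈ boxes l →
      T (s, t) < T (s', t') := by
    intro s t s' t' hs ht hne hb
    have h := mem_leadSet_of_le (hsub _ (hTn _ hb)).2.1 hs ht (hTmem _ hb)
    exact lt_of_le_of_ne (hTle _ _ h) fun h' => hne (hinj (hLsub _ (hTn _ hb) h) hb h')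
  refine ⟨T, ⟨⟨fun b hb => ⟨hT1 b hb, hTn b hb⟩, hinj, ?_⟩, ?_, ?_⟩, ?_⟩
  · rintro t ⟨ht1, htn⟩
    obtain ⟨b, hb, -⟩ := hnew t ht1 htn
    have hbt : b ∈ leadSet (V t) \ leadSet (V (t - 1)) := by rw [hb]; rfl
    have hbb := hLsub t htn hbt.1
    refine ⟨b, hbb, (hTle b t hbt.1).antisymm ?_⟩
    by_contra h
    exact hbt.2 (hmono (T b) (t - 1) (by omega) (by omega) (hTmem b hbb))
  · exact fun s t t' ht hb => hdown s t s t' le_rfl ht.le (by simp [ht.ne]) hb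
  · exact fun s s' t hs hb => hdown s t s' t hs.le le_rfl (by simp [hs.ne]) hb
  · intro b hb
    obtain ⟨a, ha, hpar⟩ := hnew (T b) (hT1 b hb) (hTn b hb)
    have h1 := hTdiff b hb
    rw [ha] at h1
    exact (congrArg (fun c : ℕ × ℕ => boxParity i c.1 c.2) h1).trans hpar

theorem lamStable_supported (i : ℕ) {S : Set (ℕ × ℕ)}
    (hrow : ∀ s t, (s, t + 1) ∈ S → (s, t) ∈ S) (hcol : ∀ s t, (s + 1, t) ∈ S → (s, t) ∈ S) :
    LamStable i (Finsupp.supported ℂ ℂ S) := by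
  refine ⟨fun x hx => ?_, fun x hx => ?_, fun x hx => ?_, fun x hx => ?_⟩ <;>
    rw [mem_supported_iff_forall] at hx ⊢ <;> rintro ⟨s, t⟩ hb
  · rw [opAlpha_apply] at hb
    exact hrow s t (hx _ (ite_ne_right_iff.1 hb).2)
  · rw [opBeta_apply] at hb
    exact hrow s t (hx _ (ite_ne_right_iff.1 hb).2)
  · rw [opAlphaStar_apply] at hb
    exact hcol s t (hx _ (ite_ne_right_iff.1 hb).2)
  · rw [opBetaStar_apply] at hb
    exact hcol s t (hx _ (ite_ne_right_iff.1 hb).2)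

theorem supported_inf_Epart {l : ℕ → ℕ} (i p : ℕ) {S : Set (ℕ × ℕ)} (hS : S ⊆ boxes l) :
    Finsupp.supported ℂ ℂ S ⊓ Epart l i p =
      Finsupp.supported ℂ ℂ (S ∩ {b | boxParity i b.1 b.2 = p}) := by
  rw [Epart, span_vB_image, ← Finsupp.supported_inter]
  congr 1
  ext b
  exact ⟨fun h => ⟨h.1, h.2.2⟩, fun h => ⟨h.1, hS h.1, h.2⟩⟩

theorem isLamSubmodule_supported {l : ℕ → ℕ} (i : ℕ) {S : Set (ℕ × ℕ)} (hS : S ⊆ boxes l)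
    (hrow : ∀ s t, (s, t + 1) ∈ S → (s, t) ∈ S) (hcol : ∀ s t, (s + 1, t) ∈ S → (s, t) ∈ S) :
    IsLamSubmodule l i (Finsupp.supported ℂ ℂ S) := by
  refine ⟨?_, lamStable_supported i hrow hcol, ?_⟩
  · rw [shapeModule, span_vB_image]
    exact Finsupp.supported_mono hS
  · rw [supported_inf_Epart i 0 hS, supported_inf_Epart i 1 hS, ← Finsupp.supported_union,
      ← Set.inter_union_distrib_left]
    congr 1
    exact (Set.inter_eq_left.2 fun b _ => boxParity_eq_zero_or_one i b.1 b.2).symm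

theorem exists_compSeries_of_tableau {l : ℕ → ℕ} (hl : IsPartition l) {n i : ℕ} {d : ℕ → ℕ}
    {T : ℕ × ℕ → ℕ} (hT : IsStandardTableau l n T)
    (hpar : ∀ b ∈ boxes l, boxParity i b.1 b.2 = d (T b)) :
    ∃ V : ℕ → Submodule ℂ Amb, IsCompSeries l i n d V := by
  obtain ⟨hbij, hrow, hcol⟩ := hT
  set S : ℕ → Set (ℕ × ℕ) := fun t => {b ∈ boxes l | T b ≤ t}
  have hsub : ∀ t, S t ⊆ boxes l := fun t b hb => hb.1
  have hfin : ∀ t, (S t).Finite := fun t => (boxes_finite hl).subset (hsub t)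
  have hS0 : S 0 = ∅ := Set.eq_empty_of_forall_notMem fun b hb => by
    have h1 := (hbij.mapsTo hb.1).1
    have h2 := hb.2
    omega
  have hinsert : ∀ t, 1 ≤ t → t ≤ n →
      ∃ b ∈ boxes l, T b = t ∧ b ∉ S (t - 1) ∧ S t = insert b (S (t - 1)) := by
    intro t ht htn
    obtain ⟨b, hb, rfl⟩ := hbij.surjOn ⟨ht, htn⟩
    refine ⟨b, hb, rfl, fun h => by have := h.2; omega, ?_⟩
    ext c
    constructor
    · rintro ⟨hc, hct⟩
      rcases hct.eq_or_lt with h | h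
      · exact Or.inl (hbij.injOn hc hb h)
      · exact Or.inr ⟨hc, by omega⟩
    · rintro (rfl | ⟨hc, hct⟩)
      · exact ⟨hb, le_rfl⟩
      · exact ⟨hc, by omega⟩
  refine ⟨fun t => Finsupp.supported ℂ ℂ (S t), ?_, ?_, ?_, ?_, ?_, ?_⟩
  · simp only [hS0, Finsupp.supported_empty]
  · rw [shapeModule, span_vB_image]
    exact congrArg _ ((hsub n).antisymm fun b hb => ⟨hb, (hbij.mapsTo hb).2⟩)
  · exact fun t _ _ => Finsupp.supported_mono fun b hb => ⟨hb.1, hb.2.trans (Nat.sub_le _ _)⟩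
  · refine fun t _ => isLamSubmodule_supported i (hsub t) ?_ ?_
    · rintro s u ⟨hb, hbt⟩
      exact ⟨(Nat.lt_succ_self u).trans hb, (hrow s u (u + 1) (Nat.lt_succ_self u) hb).le.trans hbt⟩
    · rintro s u ⟨hb, hbt⟩
      exact ⟨lt_of_lt_of_le hb (hl.1 s (s + 1) (Nat.le_succ s)),
        (hcol s (s + 1) u (Nat.lt_succ_self s) hb).le.trans hbt⟩
  · intro t
    induction t with
    | zero => exact fun _ => by rw [finrank_supported (hfin 0), hS0, Set.ncard_empty]
    | succ k ih =>
      intro hk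
      obtain ⟨b, -, -, hb, hSb⟩ := hinsert (k + 1) (by omega) hk
      have := ih (by omega)
      rw [finrank_supported (hfin _)] at this ⊢
      rw [hSb, Set.ncard_insert_of_notMem hb (hfin _)]
      simpa using this
  · intro t ht htn
    obtain ⟨b, hbb, rfl, hb, hSb⟩ := hinsert t ht htn
    have hbp : b ∈ {c : ℕ × ℕ | boxParity i c.1 c.2 = d (T b)} := hpar b hbb
    rw [supported_inf_Epart i _ (hsub _), supported_inf_Epart i _ (hsub _),
      finrank_supported ((hfin _).inter_of_left _), finrank_supported ((hfin _).inter_of_left _),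
      hSb, Set.insert_inter_of_mem hbp,
      Set.ncard_insert_of_notMem (fun h => hb h.1) ((hfin _).inter_of_left _)]

/-! Statement 4: `M(λ,i)` admits a Λ-composition series of type `d` iff there
is a standard tableau of shape `λ` whose `i`-parity equals `d`. -/

theorem comp_series_exists_iff_tableau_exists
    (l : ℕ → ℕ) (hl : IsPartition l) (n : ℕ) (hn : psize l = n)
    (i : ℕ) (hi : i ≤ 1) (d : ℕ → ℕ) (hd : ∀ t, d t ≤ 1) :
    (∃ V : ℕ → Submodule ℂ Amb, IsCompSeries l i n d V) ↔
    (∃ T : ℕ × ℕ → ℕ, IsStandardTableau l n T ∧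
      ∀ b ∈ boxes l, boxParity i b.1 b.2 = d (T b)) :=
  ⟨fun ⟨_, hV⟩ => exists_tableau_of_compSeries hl hd hV,
    fun ⟨_, hT, hpar⟩ => exists_compSeries_of_tableau hl hT hpar⟩
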